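/- For every PSST T over a finite alphabet Σ and every regular language L ⊆ Σ*, the pre-image R_T^{-1}(L) = { w ∈ Σ* | T(w) is defined and T(w) ∈ L } is a regular language. -/

import Mathlib

open scoped BigOperators

/-- A prioritized streaming string transducer (PSST) over a finite alphabet `A`:
states `Q`, string variables `X`, prioritized non-ε transitions `δ` (a duplicate-free
list of successor states, from highest to lowest priority), prioritized ε-transitions
`τ` (a pair of disjoint duplicate-free lists: those with higher resp. lower priority
than the non-ε transitions), variable-assignment functions `E` attached to transitions,
initial state `q0`, and partial output function `F`. -/
structure PSST (A : Type) [Fintype A] [DecidableEq A] : Type 1 where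
  Q : Type
  fintypeQ : Fintype Q
  decEqQ : DecidableEq Q
  X : Type
  fintypeX : Fintype X
  decEqX : DecidableEq X
  δ : Q → A → List Q
  δ_nodup : ∀ q a, (δ q a).Nodup
  τ : Q → List Q × List Q
  τ₁_nodup : ∀ q, (τ q).1.Nodup
  τ₂_nodup : ∀ q, (τ q).2.Nodup
  τ_disjoint : ∀ q q', q' ∈ (τ q).1 → q' ∉ (τ q).2
  E : Q → Option A → Q → X → List (X ⊕ A)
  q0 : Q
  F : Q → Option (List (X ⊕ A))

attribute [instance] PSST.fintypeQ PSST.decEqQ PSST.fintypeX PSST.decEqX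

namespace PSST

variable {A : Type} [Fintype A] [DecidableEq A]

/-- `(q, a, q')` is a transition of `T` (`a = none` stands for ε). -/
def IsTrans (T : PSST A) (q : T.Q) (a : Option A) (q' : T.Q) : Prop :=
  match a with
  | some σ => q' ∈ T.δ q σ
  | none => q' ∈ (T.τ q).1 ∨ q' ∈ (T.τ q).2

/-- Validity of a sequence of steps (letter-or-ε together with target state),
starting from state `q`. -/
def ValidFrom (T : PSST A) : T.Q → List (Option A × T.Q) → Prop
  | _, [] => True
  | q, (a, q') :: rest => T.IsTrans q a q' ∧ ValidFrom T q' rest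

/-- The input word consumed by a sequence of steps. -/
def wordOf (T : PSST A) (steps : List (Option A × T.Q)) : List A :=
  steps.filterMap Prod.fst

/-- The state reached after the steps, starting from `q`. -/
def endState (T : PSST A) (q : T.Q) (steps : List (Option A × T.Q)) : T.Q :=
  (steps.map Prod.snd).getLastD q

/-- The list of transitions (source, letter-or-ε, target) along a sequence of
steps starting from `q`. -/
def transList (T : PSST A) (q : T.Q) :
    List (Option A × T.Q) → List (T.Q × Option A × T.Q)
  | [] => []
  | (a, q') :: rest => (q, a, q') :: transList T q' rest

/-- Within every consecutive block of ε-transitions, no ε-transition occurs twice. -/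
def NoEpsRepeat (T : PSST A) (tl : List (T.Q × Option A × T.Q)) : Prop :=
  ∀ (k l : ℕ) (t : T.Q × Option A × T.Q), k < l → tl[k]? = some t → tl[l]? = some t → t.2.1 = none →
    (∀ (m : ℕ) (t' : T.Q × Option A × T.Q), k ≤ m → m ≤ l → tl[m]? = some t' → t'.2.1 = none) → False

/-- `steps` is a run of `T` on the input string `w`. -/
def IsRunOn (T : PSST A) (w : List A) (steps : List (Option A × T.Q)) : Prop :=
  T.ValidFrom T.q0 steps ∧ T.wordOf steps = w ∧
    T.NoEpsRepeat (T.transList T.q0 steps)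

/-- `b` occurs strictly before `b'` in the list `l`. -/
def PrecIn {β : Type} (l : List β) (b b' : β) : Prop :=
  ∃ i j : ℕ, i < j ∧ l[i]? = some b ∧ l[j]? = some b'

/-- From state `q`, the first step has higher priority than the second one. -/
def StepPrec (T : PSST A) (q : T.Q) :
    Option A × T.Q → Option A × T.Q → Prop
  | (some σ, q₁), (some σ', q₂) => σ = σ' ∧ PrecIn (T.δ q σ) q₁ q₂
  | (none, q₁), (none, q₂) =>
      PrecIn (T.τ q).1 q₁ q₂ ∨ PrecIn (T.τ q).2 q₁ q₂ ∨
        (q₁ ∈ (T.τ q).1 ∧ q₂ ∈ (T.τ q).2)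
  | (none, q₁), (some σ, q₂) => q₁ ∈ (T.τ q).1 ∧ q₂ ∈ T.δ q σ
  | (some σ, q₁), (none, q₂) => q₁ ∈ T.δ q σ ∧ q₂ ∈ (T.τ q).2

/-- Run `R` is of higher priority than run `R'` (on the same input): either `R'` is a
proper prefix of `R`, or at the first index where they differ the transition taken by
`R` precedes the one taken by `R'` in the priority order. -/
def HigherPriority (T : PSST A) (R R' : List (Option A × T.Q)) : Prop :=
  (R' <+: R ∧ R' ≠ R) ∨
    ∃ p s s' r r', R = p ++ s :: r ∧ R' = p ++ s' :: r' ∧ s ≠ s' ∧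
      T.StepPrec (T.endState T.q0 p) s s'

/-- `R` is the accepting run of `T` on `w`: it ends in a state where `F` is defined
and has the highest priority among all such runs. -/
def IsAcceptingRunOn (T : PSST A) (w : List A)
    (R : List (Option A × T.Q)) : Prop :=
  T.IsRunOn w R ∧ (T.F (T.endState T.q0 R)).isSome ∧
    ∀ R', T.IsRunOn w R' → (T.F (T.endState T.q0 R')).isSome → R' ≠ R →
      T.HigherPriority R R'

/-- Evaluate a word over `X ∪ A` under a valuation of the variables. -/
def evalWord (T : PSST A) (η : T.X → List A) (s : List (T.X ⊕ A)) : List A :=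
  (s.map (fun c => match c with | Sum.inl x => η x | Sum.inr a => [a])).flatten

/-- The valuation of the variables obtained after executing the steps from state `q`,
starting from the valuation assigning ε to every variable. -/
def valAfter (T : PSST A) (q : T.Q) (steps : List (Option A × T.Q)) :
    T.X → List A :=
  (T.transList q steps).foldl
    (fun η t x => T.evalWord η (T.E t.1 t.2.1 t.2.2 x))
    (fun _ => [])

/-- `T.Outputs w out` holds iff `T(w)` is defined and equals `out`, i.e. there is an
accepting run of `T` on `w` whose output evaluates to `out`. -/
def Outputs (T : PSST A) (w out : List A) : Prop :=
  ∃ R o, T.IsAcceptingRunOn w R ∧ T.F (T.endState T.q0 R) = some o ∧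
    out = T.evalWord (T.valAfter T.q0 R) o

/-- The number of ε-transitions of `T`, i.e. of pairs `(q, q')` with `q'`
occurring in `τ q`. -/
def numEpsTransitions (T : PSST A) : ℕ :=
  ∑ q : T.Q, ((T.τ q).1.length + (T.τ q).2.length)

/-- `T` is copyless: in every transition, each variable occurs at most once in total
among the right-hand sides of the variable assignments. -/
def Copyless (T : PSST A) : Prop :=
  ∀ q a q', T.IsTrans q a q' → ∀ x : T.X,
    (∑ x' : T.X, (T.E q a q' x').count (Sum.inl x)) ≤ 1

end PSST

/-- A language is regular iff it is accepted by some NFA with finitely many states. -/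
def IsRegularLang {A : Type} [Fintype A] [DecidableEq A] (L : Language A) : Prop :=
  ∃ (σ : Type) (_ : Fintype σ) (M : NFA A σ), M.accepts = L

namespace PSST

variable {A : Type} [Fintype A] [DecidableEq A]

/-- A step out of `q` is available if it is not an ε-transition already recorded in `S`. -/
def Avail (T : PSST A) (q : T.Q) (S : Set (T.Q × T.Q)) (s : Option A × T.Q) : Prop :=
  s.1 = none → (q, s.2) ∉ S

/-- The set of ε-transitions used in the current ε-block, updated by the step `s` out of `q`. -/
def nextUsed (T : PSST A) (q : T.Q) (S : Set (T.Q × T.Q)) (s : Option A × T.Q) :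
    Set (T.Q × T.Q) :=
  match s.1 with
  | none => insert (q, s.2) S
  | some _ => ∅

/-- The steps from `q` repeat no ε-transition within an ε-block, and the initial ε-block
avoids the ε-transitions in `S`. -/
def EpsFresh (T : PSST A) : T.Q → Set (T.Q × T.Q) → List (Option A × T.Q) → Prop
  | _, _, [] => True
  | q, S, s :: R => T.Avail q S s ∧ EpsFresh T s.2 (T.nextUsed q S s) R

/-- No ε-transition in the initial ε-block of `tl` belongs to `S`. -/
def InitAvoids (T : PSST A) (S : Set (T.Q × T.Q)) (tl : List (T.Q × Option A × T.Q)) : Prop :=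
  ∀ (l : ℕ) (t : T.Q × Option A × T.Q), tl[l]? = some t →
    (∀ (m : ℕ) (t' : T.Q × Option A × T.Q), m ≤ l → tl[m]? = some t' → t'.2.1 = none) →
    (t.1, t.2.2) ∉ S

theorem noEpsRepeat_some_cons (T : PSST A) (q q' : T.Q) (a : A)
    (tl : List (T.Q × Option A × T.Q)) :
    T.NoEpsRepeat ((q, some a, q') :: tl) ↔ T.NoEpsRepeat tl := by
  constructor
  · intro h k l t hkl hk hl ht hm
    refine h (k + 1) (l + 1) t (by omega) (by simpa using hk) (by simpa using hl) ht ?_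
    intro m t' h1 h2 h3
    obtain ⟨m, rfl⟩ : ∃ m', m = m' + 1 := ⟨m - 1, by omega⟩
    exact hm m t' (by omega) (by omega) (by simpa using h3)
  · intro h k l t hkl hk hl ht hm
    obtain ⟨l, rfl⟩ : ∃ l', l = l' + 1 := ⟨l - 1, by omega⟩
    cases k with
    | zero => simp at hk; subst hk; simp at ht
    | succ k =>
      refine h k l t (by omega) (by simpa using hk) (by simpa using hl) ht ?_
      intro m t' h1 h2 h3
      exact hm (m + 1) t' (by omega) (by omega) (by simpa using h3)

theorem noEpsRepeat_none_cons (T : PSST A) (q q' : T.Q)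
    (tl : List (T.Q × Option A × T.Q)) :
    T.NoEpsRepeat ((q, none, q') :: tl) ↔ T.NoEpsRepeat tl ∧ T.InitAvoids {(q, q')} tl := by
  constructor
  · intro h
    refine ⟨?_, ?_⟩
    · intro k l t hkl hk hl ht hm
      refine h (k + 1) (l + 1) t (by omega) (by simpa using hk) (by simpa using hl) ht ?_
      intro m t' h1 h2 h3
      obtain ⟨m, rfl⟩ : ∃ m', m = m' + 1 := ⟨m - 1, by omega⟩
      exact hm m t' (by omega) (by omega) (by simpa using h3)
    · intro l t hl hm hmem
      have ht := hm l t le_rfl hl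
      have hq : t = (q, none, q') := by
        obtain ⟨t1, t2, t3⟩ := t
        simp_all
      refine h 0 (l + 1) t (by omega) (by simp [hq]) (by simpa using hl) ht ?_
      intro m t' _ h2 h3
      cases m with
      | zero => simp at h3; subst h3; rfl
      | succ m => exact hm m t' (by omega) (by simpa using h3)
  · rintro ⟨h, hi⟩ k l t hkl hk hl ht hm
    obtain ⟨l, rfl⟩ : ∃ l', l = l' + 1 := ⟨l - 1, by omega⟩
    cases k with
    | zero =>
      simp at hk
      subst hk
      refine hi l _ (by simpa using hl) ?_ (Set.mem_singleton _)
      intro m t' h2 h3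
      exact hm (m + 1) t' (by omega) (by omega) (by simpa using h3)
    | succ k =>
      refine h k l t (by omega) (by simpa using hk) (by simpa using hl) ht ?_
      intro m t' h1 h2 h3
      exact hm (m + 1) t' (by omega) (by omega) (by simpa using h3)

theorem initAvoids_some_cons (T : PSST A) (S : Set (T.Q × T.Q)) (q q' : T.Q) (a : A)
    (tl : List (T.Q × Option A × T.Q)) :
    T.InitAvoids S ((q, some a, q') :: tl) := by
  intro l t _ hm
  simpa using hm 0 _ (by omega) rfl

theorem initAvoids_none_cons (T : PSST A) (S : Set (T.Q × T.Q)) (q q' : T.Q)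
    (tl : List (T.Q × Option A × T.Q)) :
    T.InitAvoids S ((q, none, q') :: tl) ↔ (q, q') ∉ S ∧ T.InitAvoids S tl := by
  constructor
  · intro h
    refine ⟨?_, ?_⟩
    · refine h 0 _ rfl ?_
      intro m t' h2 h3
      obtain rfl : m = 0 := by omega
      simp at h3; subst h3; rfl
    · intro l t hl hm
      refine h (l + 1) t (by simpa using hl) ?_
      intro m t' h2 h3
      cases m with
      | zero => simp at h3; subst h3; rfl
      | succ m => exact hm m t' (by omega) (by simpa using h3)
  · rintro ⟨h0, h⟩ l t hl hm
    cases l with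
    | zero => simp at hl; subst hl; exact h0
    | succ l =>
      refine h l t (by simpa using hl) ?_
      intro m t' h2 h3
      exact hm (m + 1) t' (by omega) (by simpa using h3)

theorem initAvoids_insert (T : PSST A) (p : T.Q × T.Q) (S : Set (T.Q × T.Q))
    (tl : List (T.Q × Option A × T.Q)) :
    T.InitAvoids (insert p S) tl ↔ T.InitAvoids {p} tl ∧ T.InitAvoids S tl := by
  simp only [InitAvoids, Set.mem_insert_iff, Set.mem_singleton_iff, not_or]
  grind

theorem epsFresh_iff (T : PSST A) (q : T.Q) (S : Set (T.Q × T.Q))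
    (R : List (Option A × T.Q)) :
    T.EpsFresh q S R ↔ T.NoEpsRepeat (T.transList q R) ∧ T.InitAvoids S (T.transList q R) := by
  induction R generalizing q S with
  | nil => simp [EpsFresh, transList, NoEpsRepeat, InitAvoids]
  | cons s R ih =>
    obtain ⟨o, q'⟩ := s
    cases o with
    | none =>
      simp only [EpsFresh, Avail, nextUsed, transList, ih, noEpsRepeat_none_cons,
        initAvoids_none_cons, initAvoids_insert]
      tauto
    | some a =>
      have he : T.InitAvoids ∅ (T.transList q' R) := fun _ _ _ _ => Set.notMem_empty _
      simp [EpsFresh, Avail, nextUsed, transList, ih, noEpsRepeat_some_cons,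
        initAvoids_some_cons, he]

/-- `R` is an accepting continuation on `w` from `q`, when the ε-transitions in `S` have
already been used in the current ε-block. -/
def Accepts (T : PSST A) (q : T.Q) (S : Set (T.Q × T.Q)) (w : List A)
    (R : List (Option A × T.Q)) : Prop :=
  T.ValidFrom q R ∧ T.wordOf R = w ∧ T.EpsFresh q S R ∧ (T.F (T.endState q R)).isSome

/-- `HigherPriority` for continuations from an arbitrary state `q`. -/
def HigherFrom (T : PSST A) (q : T.Q) (R R' : List (Option A × T.Q)) : Prop :=
  (R' <+: R ∧ R' ≠ R) ∨
    ∃ p s s' r r', R = p ++ s :: r ∧ R' = p ++ s' :: r' ∧ s ≠ s' ∧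
      T.StepPrec (T.endState q p) s s'

/-- `R` is an accepting continuation of highest priority. -/
def IsBest (T : PSST A) (q : T.Q) (S : Set (T.Q × T.Q)) (w : List A)
    (R : List (Option A × T.Q)) : Prop :=
  T.Accepts q S w R ∧ ∀ R', T.Accepts q S w R' → R' ≠ R → T.HigherFrom q R R'

theorem isBest_q0_iff (T : PSST A) (w : List A) (R : List (Option A × T.Q)) :
    T.IsBest T.q0 ∅ w R ↔ T.IsAcceptingRunOn w R := by
  have he (tl) : T.InitAvoids ∅ tl := fun _ _ _ _ => Set.notMem_empty _
  simp only [IsBest, IsAcceptingRunOn, Accepts, IsRunOn, epsFresh_iff, he, HigherFrom,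
    HigherPriority]
  grind

theorem endState_cons (T : PSST A) (q : T.Q) (s : Option A × T.Q)
    (R : List (Option A × T.Q)) : T.endState q (s :: R) = T.endState s.2 R := by
  simp only [endState, List.map_cons, List.getLastD_cons]

theorem accepts_nil (T : PSST A) (q : T.Q) (S : Set (T.Q × T.Q)) (w : List A) :
    T.Accepts q S w [] ↔ w = [] ∧ (T.F q).isSome := by
  rw [eq_comm (a := w)]
  simp [Accepts, ValidFrom, wordOf, EpsFresh, endState]

theorem accepts_cons (T : PSST A) (q : T.Q) (S : Set (T.Q × T.Q)) (w : List A)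
    (s : Option A × T.Q) (R : List (Option A × T.Q)) :
    T.Accepts q S w (s :: R) ↔ T.IsTrans q s.1 s.2 ∧ T.Avail q S s ∧
      ∃ w', w = s.1.toList ++ w' ∧ T.Accepts s.2 (T.nextUsed q S s) w' R := by
  obtain ⟨o, q'⟩ := s
  cases o <;> simp only [Accepts, ValidFrom, wordOf, EpsFresh, endState_cons] <;> grind

theorem higherFrom_nil_left (T : PSST A) (q : T.Q) (R : List (Option A × T.Q)) :
    ¬ T.HigherFrom q [] R := by
  simp [HigherFrom]

theorem higherFrom_nil_right (T : PSST A) (q : T.Q) (s : Option A × T.Q)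
    (R : List (Option A × T.Q)) : T.HigherFrom q (s :: R) [] := by
  simp [HigherFrom]

theorem higherFrom_cons_same (T : PSST A) (q : T.Q) (s : Option A × T.Q)
    (R R' : List (Option A × T.Q)) :
    T.HigherFrom q (s :: R) (s :: R') ↔ T.HigherFrom s.2 R R' := by
  refine or_congr (by simp) ?_
  constructor
  · rintro ⟨p, t, t', r, r', h1, h2, hne, hp⟩
    cases p with
    | nil => simp_all
    | cons u p =>
      simp only [List.cons_append, List.cons.injEq] at h1 h2
      obtain ⟨rfl, h1⟩ := h1
      exact ⟨p, t, t', r, r', h1, h2.2, hne, by rwa [endState_cons] at hp⟩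
  · rintro ⟨p, t, t', r, r', h1, h2, hne, hp⟩
    exact ⟨s :: p, t, t', r, r', by simp [h1], by simp [h2], hne, by rwa [endState_cons]⟩

theorem higherFrom_cons_ne (T : PSST A) (q : T.Q) {s s' : Option A × T.Q} (h : s ≠ s')
    (R R' : List (Option A × T.Q)) :
    T.HigherFrom q (s :: R) (s' :: R') ↔ T.StepPrec q s s' := by
  constructor
  · rintro (⟨hp, -⟩ | ⟨p, t, t', r, r', h1, h2, hne, hp⟩)
    · simp [h.symm] at hp
    · cases p with
      | nil =>
        simp only [List.nil_append, List.cons.injEq] at h1 h2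
        obtain ⟨rfl, -⟩ := h1
        obtain ⟨rfl, -⟩ := h2
        exact hp
      | cons u p => simp_all
  · intro hp
    exact Or.inr ⟨[], s, s', R, R', rfl, rfl, h, hp⟩

/-- Some accepting continuation exists. -/
def CanAccept (T : PSST A) (w : List A) (q : T.Q) (S : Set (T.Q × T.Q)) : Prop :=
  ∃ R, T.Accepts q S w R

/-- The step `s` out of `q` can be taken on input `w`, leaving an input and a configuration
that satisfy `P`. -/
def StepTo (T : PSST A) (P : List A → T.Q → Set (T.Q × T.Q) → Prop) (w : List A) (q : T.Q)
    (S : Set (T.Q × T.Q)) (s : Option A × T.Q) : Prop :=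
  T.IsTrans q s.1 s.2 ∧ T.Avail q S s ∧
    ∃ w', w = s.1.toList ++ w' ∧ P w' s.2 (T.nextUsed q S s)

theorem canAccept_iff (T : PSST A) (w : List A) (q : T.Q) (S : Set (T.Q × T.Q)) :
    T.CanAccept w q S ↔ (w = [] ∧ (T.F q).isSome) ∨ ∃ s, T.StepTo T.CanAccept w q S s := by
  constructor
  · rintro ⟨R, hR⟩
    cases R with
    | nil => exact Or.inl ((T.accepts_nil q S w).1 hR)
    | cons s R =>
      obtain ⟨h1, h2, w', h3, h4⟩ := (T.accepts_cons q S w s R).1 hR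
      exact Or.inr ⟨s, h1, h2, w', h3, R, h4⟩
  · rintro (h | ⟨s, h1, h2, w', h3, R, h4⟩)
    · exact ⟨[], (T.accepts_nil q S w).2 h⟩
    · exact ⟨s :: R, (T.accepts_cons q S w s R).2 ⟨h1, h2, w', h3, h4⟩⟩

theorem isBest_nil (T : PSST A) (q : T.Q) (S : Set (T.Q × T.Q)) (w : List A) :
    T.IsBest q S w [] ↔
      (w = [] ∧ (T.F q).isSome) ∧ ∀ s, ¬ T.StepTo T.CanAccept w q S s := by
  simp only [IsBest, accepts_nil, higherFrom_nil_left]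
  refine and_congr_right fun _ => ⟨?_, ?_⟩
  · rintro h s ⟨h1, h2, w', h3, R, h4⟩
    exact h (s :: R) ((T.accepts_cons q S w s R).2 ⟨h1, h2, w', h3, h4⟩) (by simp)
  · intro h R hR hne
    cases R with
    | nil => exact hne rfl
    | cons s R =>
      obtain ⟨h1, h2, w', h3, h4⟩ := (T.accepts_cons q S w s R).1 hR
      exact h s ⟨h1, h2, w', h3, R, h4⟩

theorem isBest_cons (T : PSST A) (q : T.Q) (S : Set (T.Q × T.Q)) (w : List A)
    (s : Option A × T.Q) (R : List (Option A × T.Q)) :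
    T.IsBest q S w (s :: R) ↔ T.StepTo (fun w' q' S' => T.IsBest q' S' w' R) w q S s ∧
      ∀ s', s' ≠ s → T.StepTo T.CanAccept w q S s' → T.StepPrec q s s' := by
  constructor
  · rintro ⟨hA, hB⟩
    obtain ⟨h1, h2, w', h3, h4⟩ := (T.accepts_cons q S w s R).1 hA
    refine ⟨⟨h1, h2, w', h3, h4, ?_⟩, ?_⟩
    · intro R' hR' hne
      exact (T.higherFrom_cons_same q s R R').1
        (hB (s :: R') ((T.accepts_cons q S w s R').2 ⟨h1, h2, w', h3, hR'⟩) (by simpa using hne))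
    · rintro s' hne ⟨k1, k2, u, k3, R', k4⟩
      exact (T.higherFrom_cons_ne q hne.symm R R').1
        (hB (s' :: R') ((T.accepts_cons q S w s' R').2 ⟨k1, k2, u, k3, k4⟩) (by simp [hne]))
  · rintro ⟨⟨h1, h2, w', h3, h4, h5⟩, h6⟩
    refine ⟨(T.accepts_cons q S w s R).2 ⟨h1, h2, w', h3, h4⟩, ?_⟩
    intro R' hR' hne
    cases R' with
    | nil => exact T.higherFrom_nil_right q s R
    | cons s' R' =>
      obtain ⟨k1, k2, u, k3, k4⟩ := (T.accepts_cons q S w s' R').1 hR'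
      by_cases hs : s' = s
      · subst hs
        obtain rfl : w' = u := List.append_cancel_left (h3.symm.trans k3)
        exact (T.higherFrom_cons_same q s' R R').2 (h5 R' k4 (by simpa using hne))
      · exact (T.higherFrom_cons_ne q (Ne.symm hs) R R').2 (h6 s' hs ⟨k1, k2, u, k3, R', k4⟩)

section Effect

variable {σ : Type}

/-- The state transformation of `M` induced by a word over variables and letters, when each
variable `x` acts by `v x`. -/
def act (T : PSST A) (M : DFA A σ) (v : T.X → σ → σ) (o : List (T.X ⊕ A)) (p : σ) : σ :=
  o.foldl (fun p c => match c with | Sum.inl x => v x p | Sum.inr a => M.step p a) p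

/-- The output of the continuation `R` from `q` is accepted by `M`, when the variables
initially act by `v`. -/
def OutputAccepted (T : PSST A) (M : DFA A σ) :
    T.Q → (T.X → σ → σ) → List (Option A × T.Q) → Prop
  | q, v, [] => ∃ o, T.F q = some o ∧ T.act M v o M.start ∈ M.accept
  | q, v, s :: R => OutputAccepted T M s.2 (fun x => T.act M v (T.E q s.1 s.2 x)) R

theorem act_evalFrom (T : PSST A) (M : DFA A σ) (η : T.X → List A) (o : List (T.X ⊕ A)) :
    T.act M (fun x p => M.evalFrom p (η x)) o = fun p => M.evalFrom p (T.evalWord η o) := by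
  funext p
  induction o generalizing p with
  | nil => rfl
  | cons c o ih =>
    have hstep : ∀ p', T.evalWord η (c :: o) =
        (match c with | Sum.inl x => η x | Sum.inr a => [a]) ++ T.evalWord η o ∧
        T.act M (fun x p => M.evalFrom p (η x)) (c :: o) p' =
          T.act M (fun x p => M.evalFrom p (η x)) o
            (match c with | Sum.inl x => M.evalFrom p' (η x) | Sum.inr a => M.step p' a) :=
      fun p' => ⟨rfl, by cases c <;> rfl⟩
    rw [(hstep p).2, (hstep p).1, ih, DFA.evalFrom_of_append]
    cases c <;> rfl

theorem outputAccepted_iff (T : PSST A) (M : DFA A σ) (q : T.Q) (η : T.X → List A)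
    (R : List (Option A × T.Q)) :
    T.OutputAccepted M q (fun x p => M.evalFrom p (η x)) R ↔
      ∃ o, T.F (T.endState q R) = some o ∧
        T.evalWord ((T.transList q R).foldl
          (fun η t x => T.evalWord η (T.E t.1 t.2.1 t.2.2 x)) η) o ∈ M.accepts := by
  induction R generalizing q η with
  | nil =>
    simp only [OutputAccepted, act_evalFrom]
    rfl
  | cons s R ih =>
    simp only [OutputAccepted, act_evalFrom, endState_cons]
    exact ih s.2 fun x => T.evalWord η (T.E q s.1 s.2 x)

/-- Some best continuation on `w` has an output accepted by `M`. -/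
def BestAccepted (T : PSST A) (M : DFA A σ) (w : List A) (q : T.Q) (S : Set (T.Q × T.Q))
    (v : T.X → σ → σ) : Prop :=
  ∃ R, T.IsBest q S w R ∧ T.OutputAccepted M q v R

theorem bestAccepted_iff (T : PSST A) (M : DFA A σ) (w : List A) (q : T.Q)
    (S : Set (T.Q × T.Q)) (v : T.X → σ → σ) :
    T.BestAccepted M w q S v ↔
      (((w = [] ∧ (T.F q).isSome) ∧ ∀ s, ¬ T.StepTo T.CanAccept w q S s) ∧
        T.OutputAccepted M q v []) ∨
      ∃ s, T.StepTo (fun w' q' S' =>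
          T.BestAccepted M w' q' S' fun x => T.act M v (T.E q s.1 s.2 x)) w q S s ∧
        ∀ s', s' ≠ s → T.StepTo T.CanAccept w q S s' → T.StepPrec q s s' := by
  constructor
  · rintro ⟨R, hR, hO⟩
    cases R with
    | nil => exact Or.inl ⟨(T.isBest_nil q S w).1 hR, hO⟩
    | cons s R =>
      obtain ⟨⟨h1, h2, w', h3, h4⟩, h5⟩ := (T.isBest_cons q S w s R).1 hR
      exact Or.inr ⟨s, ⟨h1, h2, w', h3, R, h4, hO⟩, h5⟩
  · rintro (⟨h, hO⟩ | ⟨s, ⟨h1, h2, w', h3, R, h4, hO⟩, h5⟩)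
    · exact ⟨[], (T.isBest_nil q S w).2 h, hO⟩
    · exact ⟨s :: R, (T.isBest_cons q S w s R).2 ⟨⟨h1, h2, w', h3, h4⟩, h5⟩, hO⟩

/-- Taking a step on `a :: u` leads to comparable situations for different `u`, provided
reading `a` does and using up one more ε-transition does. -/
theorem stepTo_cons_congr (T : PSST A) {P : List A → T.Q → Set (T.Q × T.Q) → Prop}
    {a : A} {u u' : List A} {q : T.Q} {S : Set (T.Q × T.Q)}
    (hletter : ∀ q', P u q' ∅ ↔ P u' q' ∅)
    (heps : ∀ q', (q, q') ∉ S →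
      (P (a :: u) q' (insert (q, q') S) ↔ P (a :: u') q' (insert (q, q') S)))
    (s : Option A × T.Q) :
    T.StepTo P (a :: u) q S s ↔ T.StepTo P (a :: u') q S s := by
  refine and_congr_right fun _ => and_congr_right fun hav => ?_
  obtain ⟨o, q'⟩ := s
  cases o with
  | none => simpa [nextUsed] using heps q' (hav rfl)
  | some b => simp [nextUsed, hletter]

/-- Induction on the number of pairs of states outside `S`. -/
theorem used_induction (T : PSST A) {P : Set (T.Q × T.Q) → Prop}
    (h : ∀ S, (∀ p ∉ S, P (insert p S)) → P S) (S : Set (T.Q × T.Q)) : P S := by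
  induction hn : Sᶜ.ncard using Nat.strong_induction_on generalizing S with
  | _ n ih =>
    refine h S fun p hp => ih _ ?_ _ rfl
    rw [← hn]
    exact Set.ncard_lt_ncard (compl_lt_compl_iff_lt.2 (Set.ssubset_insert hp)) (Set.toFinite _)

theorem canAccept_cons_congr (T : PSST A) {u u' : List A}
    (hu : ∀ q S, T.CanAccept u q S ↔ T.CanAccept u' q S) (a : A) (q : T.Q)
    (S : Set (T.Q × T.Q)) : T.CanAccept (a :: u) q S ↔ T.CanAccept (a :: u') q S := by
  induction S using used_induction generalizing q with
  | h S ih =>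
    simp only [T.canAccept_iff (_ :: _), List.cons_ne_nil,
      T.stepTo_cons_congr (fun q' => hu q' ∅) (fun q' hq' => ih (q, q') hq' q')]

theorem bestAccepted_cons_congr (T : PSST A) (M : DFA A σ) {u u' : List A}
    (hu : ∀ q S, T.CanAccept u q S ↔ T.CanAccept u' q S)
    (hb : ∀ q S v, T.BestAccepted M u q S v ↔ T.BestAccepted M u' q S v) (a : A) (q : T.Q)
    (S : Set (T.Q × T.Q)) (v : T.X → σ → σ) :
    T.BestAccepted M (a :: u) q S v ↔ T.BestAccepted M (a :: u') q S v := by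
  induction S using used_induction generalizing q v with
  | h S ih =>
    have hc := T.stepTo_cons_congr (a := a) (q := q) (S := S) (fun q' => hu q' ∅)
      (fun q' _ => T.canAccept_cons_congr hu a q' _)
    rw [bestAccepted_iff, bestAccepted_iff]
    simp only [List.cons_ne_nil, false_and, false_or, hc]
    refine exists_congr fun s => and_congr_left fun _ => ?_
    exact T.stepTo_cons_congr (fun q' => hb q' ∅ _) (fun q' hq' => ih (q, q') hq' q' _) s

end Effect

end PSST

/-- A language saturated by a finite-valued left congruence is regular. -/
theorem isRegularLang_of_leftCongruence {A Y : Type} [Fintype A] [DecidableEq A] [Finite Y]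
    (φ : List A → Y) (hφ : ∀ a u u', φ u = φ u' → φ (a :: u) = φ (a :: u'))
    (L : Language A) (hL : ∀ u u', φ u = φ u' → u ∈ L → u' ∈ L) : IsRegularLang L := by
  let M : NFA A Y :=
    { step := fun y a => {y' | ∃ u, φ u = y' ∧ φ (a :: u) = y}
      start := φ '' L
      accept := {φ []} }
  have key : ∀ (w : List A) (C : Set Y), φ [] ∈ M.evalFrom C w ↔ φ w ∈ C := by
    intro w
    induction w with
    | nil => simp
    | cons a w ih =>
      intro C
      rw [NFA.evalFrom_cons, ih, NFA.mem_stepSet]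
      constructor
      · rintro ⟨y, hy, u, hu, rfl⟩
        rwa [← hφ a u w hu]
      · intro h
        exact ⟨_, h, w, rfl, rfl⟩
  refine ⟨Y, Fintype.ofFinite Y, M, ?_⟩
  ext w
  rw [NFA.mem_accepts]
  constructor
  · rintro ⟨y, rfl, hy⟩
    obtain ⟨u, hu, he⟩ := (key w _).1 hy
    exact hL u w he hu
  · intro hw
    exact ⟨φ [], rfl, (key w _).2 ⟨w, hw, rfl⟩⟩

/-- The pre-image of a regular language under a PSST is regular. -/
theorem psst_preimage_regular {A : Type} [Fintype A] [DecidableEq A]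
    (T : PSST A) (L : Language A) (hL : IsRegularLang L) :
    IsRegularLang { w : List A | ∃ out, T.Outputs w out ∧ out ∈ L } := by
  obtain ⟨σ, _, N, rfl⟩ := hL
  rw [← N.toDFA_correct]
  set M := N.toDFA
  have hmem (w : List A) : (∃ out, T.Outputs w out ∧ out ∈ M.accepts) ↔
      T.BestAccepted M w T.q0 ∅ (fun _ p => p) := by
    have h := fun R => T.outputAccepted_iff M T.q0 (fun _ => []) R
    simp only [DFA.evalFrom_nil] at h
    simp only [PSST.BestAccepted, PSST.isBest_q0_iff, h, PSST.Outputs, PSST.valAfter]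
    constructor
    · rintro ⟨out, ⟨R, o, hR, ho, rfl⟩, hout⟩
      exact ⟨R, hR, o, ho, hout⟩
    · rintro ⟨R, hR, o, ho, hout⟩
      exact ⟨_, ⟨R, o, hR, ho, rfl⟩, hout⟩
  let φ (w : List A) :
      (T.Q → Set (T.Q × T.Q) → Prop) × (T.Q → Set (T.Q × T.Q) → (T.X → Set σ → Set σ) → Prop) :=
    (T.CanAccept w, T.BestAccepted M w)
  refine isRegularLang_of_leftCongruence φ ?_ _ ?_
  · intro a u u' h
    simp only [φ, Prod.mk.injEq, funext_iff, eq_iff_iff] at h ⊢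
    exact ⟨T.canAccept_cons_congr h.1 a, T.bestAccepted_cons_congr M h.1 h.2 a⟩
  · intro u u' h hu
    have h2 : T.BestAccepted M u = T.BestAccepted M u' := congrArg Prod.snd h
    exact (hmem u').2 (h2 ▸ (hmem u).1 hu)
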